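/- arXiv:2205.11168 — 3 statements merged into one kernel-verified Lean document; each statement's English description precedes it below -/
import Mathlib

section
/- Let 0 < λ_min ≤ λ_max be real numbers. For all α, β ∈ [λ_min, λ_max], one has log(α/β) + β/α − 1 ≥ (λ_min³/(2 λ_max)) · (1/β − 1/α)². -/
/-- For `1 ≤ x`, `x - 1 - log x` dominates `(x - 1)² / (2 x)`. -/
theorem sub_sq_div_le_sub_one_sub_log {x : ℝ} (hx : 1 ≤ x) :
    (x - 1) ^ 2 / (2 * x) ≤ x - 1 - Real.log x := by
  have hx0 : 0 < x := by linarith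
  have h := Real.self_le_sinh_iff.2 (Real.log_nonneg hx)
  rw [Real.sinh_log hx0] at h
  have e : (x - 1) ^ 2 / (2 * x) = x - 1 - (x - x⁻¹) / 2 := by
    field_simp
    ring
  linarith

/-- For `0 < x ≤ 1`, `x - 1 - log x` dominates `(x - 1)² / 2`. -/
theorem sub_sq_half_le_sub_one_sub_log {x : ℝ} (hx0 : 0 < x) (hx : x ≤ 1) :
    (x - 1) ^ 2 / 2 ≤ x - 1 - Real.log x := by
  have h := Real.le_log_one_add_of_nonneg (sub_nonneg.2 ((one_le_inv₀ hx0).2 hx))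
  rw [add_sub_cancel, Real.log_inv] at h
  have e : 2 * (x⁻¹ - 1) / (x⁻¹ - 1 + 2) = (1 - x) + (x - 1) ^ 2 / (1 + x) := by
    have hsum : x⁻¹ - 1 + 2 = (1 + x) / x := by
      field_simp
      ring
    have hne : 1 + x ≠ 0 := by positivity
    rw [hsum]
    field_simp
    ring
  have : (x - 1) ^ 2 / 2 ≤ (x - 1) ^ 2 / (1 + x) := by
    gcongr
    linarith
  linarith

/-- For `0 < λ_min ≤ λ_max` and `α, β ∈ [λ_min, λ_max]`, the KL divergence between
exponential distributions with rates `α` and `β`, namely `log (α/β) + β/α − 1`,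
is at least `(λ_min³ / (2 λ_max)) · (1/β − 1/α)²`. -/
theorem kl_exp_ge_inv_sq (lmin lmax : ℝ) (hmin : 0 < lmin) (hle : lmin ≤ lmax)
    (α β : ℝ) (hα : α ∈ Set.Icc lmin lmax) (hβ : β ∈ Set.Icc lmin lmax) :
    Real.log (α / β) + β / α - 1 ≥ lmin ^ 3 / (2 * lmax) * (1 / β - 1 / α) ^ 2 := by
  obtain ⟨hα₁, hα₂⟩ := hα
  obtain ⟨hβ₁, hβ₂⟩ := hβ
  have hα : 0 < α := by linarith
  have hβ : 0 < β := by linarith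
  have hmax : 0 < lmax := by linarith
  have hlog : Real.log (α / β) = -Real.log (β / α) := by
    rw [← Real.log_inv, inv_div]
  have hrhs : lmin ^ 3 / (2 * lmax) * (1 / β - 1 / α) ^ 2
      = lmin ^ 3 / (lmax * β ^ 2) * ((β / α - 1) ^ 2 / 2) := by
    field_simp
    ring
  rw [hlog, hrhs]
  rcases le_total β α with h | h
  · have hc : lmin ^ 3 / (lmax * β ^ 2) ≤ 1 := by
      rw [div_le_one (by positivity)]
      calc lmin ^ 3 = lmin * lmin ^ 2 := by ring
        _ ≤ lmax * β ^ 2 := by gcongr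
    have hk := sub_sq_half_le_sub_one_sub_log (div_pos hβ hα) ((div_le_one hα).2 h)
    have := mul_le_of_le_one_left (by positivity : 0 ≤ (β / α - 1) ^ 2 / 2) hc
    linarith
  · have hc : lmin ^ 3 / (lmax * β ^ 2) ≤ α / β := by
      rw [div_le_div_iff₀ (by positivity) hβ]
      calc lmin ^ 3 * β = lmin * lmin * lmin * β := by ring
        _ ≤ α * lmax * β * β := by gcongr
        _ = α * (lmax * β ^ 2) := by ring
    have hk := sub_sq_div_le_sub_one_sub_log ((one_le_div hα).2 h)
    have := mul_le_mul_of_nonneg_right hc (by positivity : 0 ≤ (β / α - 1) ^ 2 / 2)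
    have e : α / β * ((β / α - 1) ^ 2 / 2) = (β / α - 1) ^ 2 / (2 * (β / α)) := by
      field_simp
    linarith
end

section
/- Let 0 < λ_min ≤ λ_max be real numbers with λ_min³ ≤ λ_max, let S be a finite set, and let p, q be probability mass functions on S such that q(j) > 0 whenever p(j) > 0. Then for all λ, λ̄ ∈ [λ_min, λ_max]: Σ_{j ∈ S, p(j) > 0} p(j) log(p(j)/q(j)) + log(λ/λ̄) + λ̄/λ − 1 ≥ (λ_min³/(4 λ_max)) · ( Σ_{j ∈ S} |p(j) − q(j)| + |1/λ̄ − 1/λ| )². -/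
open Finset

/-- The derivative of the logarithm minus its Padé approximant at `1`. -/
lemma hasDerivAt_log_sub_pade {u : ℝ} (hu : 0 < u) :
    HasDerivAt (fun x : ℝ => Real.log x - (x - 1) * (5 * x + 1) / (2 * x * (x + 2)))
      ((u - 1) ^ 3 / (u ^ 2 * (u + 2) ^ 2)) u := by
  have hnum : HasDerivAt (fun x : ℝ => (x - 1) * (5 * x + 1))
      (1 * (5 * u + 1) + (u - 1) * (5 * 1)) u :=
    ((hasDerivAt_id' u).sub_const 1).mul (((hasDerivAt_id' u).const_mul 5).add_const 1)
  have hden : HasDerivAt (fun x : ℝ => 2 * x * (x + 2)) (2 * 1 * (u + 2) + 2 * u * 1) u :=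
    ((hasDerivAt_id' u).const_mul 2).mul ((hasDerivAt_id' u).add_const 2)
  refine ((Real.hasDerivAt_log hu.ne').sub (hnum.div hden (by positivity))).congr_deriv ?_
  field_simp
  ring

lemma pade_le_log {u : ℝ} (hu : 0 < u) :
    (u - 1) * (5 * u + 1) / (2 * u * (u + 2)) ≤ Real.log u := by
  set f : ℝ → ℝ := fun x => Real.log x - (x - 1) * (5 * x + 1) / (2 * x * (x + 2)) with hf
  have hderiv : ∀ x : ℝ, 0 < x → HasDerivAt f ((x - 1) ^ 3 / (x ^ 2 * (x + 2) ^ 2)) x :=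
    fun x hx => hasDerivAt_log_sub_pade hx
  have hf1 : f 1 = 0 := by simp [hf]
  suffices h : f 1 ≤ f u by
    rw [hf1] at h
    exact sub_nonneg.mp h
  rcases le_total u 1 with h1 | h1
  · have hanti : AntitoneOn f (Set.Icc u 1) := by
      refine antitoneOn_of_hasDerivWithinAt_nonpos (convex_Icc u 1)
        (fun x hx => (hderiv x (hu.trans_le hx.1)).continuousAt.continuousWithinAt)
        (fun x hx => (hderiv x (hu.trans_le (interior_subset hx).1)).hasDerivWithinAt)
        (fun x hx => ?_)
      have hx1 : x - 1 ≤ 0 := sub_nonpos.mpr (interior_subset hx).2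
      exact div_nonpos_of_nonpos_of_nonneg
        (Odd.pow_nonpos_iff (by decide) |>.mpr hx1) (by positivity)
    exact hanti (Set.left_mem_Icc.mpr h1) (Set.right_mem_Icc.mpr h1) h1
  · have hmono : MonotoneOn f (Set.Icc 1 u) := by
      refine monotoneOn_of_hasDerivWithinAt_nonneg (convex_Icc 1 u)
        (fun x hx => (hderiv x (one_pos.trans_le hx.1)).continuousAt.continuousWithinAt)
        (fun x hx => (hderiv x (one_pos.trans_le (interior_subset hx).1)).hasDerivWithinAt)
        (fun x hx => ?_)
      have hx1 : 0 ≤ x - 1 := sub_nonneg.mpr (interior_subset hx).1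
      positivity
    exact hmono (Set.left_mem_Icc.mpr h1) (Set.right_mem_Icc.mpr h1) h1

/-- A quadratic lower bound for one summand of the unnormalised relative entropy. -/
lemma sq_sub_div_le_mul_log_div {a b : ℝ} (ha : 0 < a) (hb : 0 < b) :
    3 * (a - b) ^ 2 / (2 * a + 4 * b) ≤ a * Real.log (a / b) - a + b := by
  have h := mul_le_mul_of_nonneg_left (pade_le_log (div_pos ha hb)) ha.le
  have heq : a * ((a / b - 1) * (5 * (a / b) + 1) / (2 * (a / b) * (a / b + 2)))
      = 3 * (a - b) ^ 2 / (2 * a + 4 * b) + a - b := by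
    have h1 : a + 2 * b ≠ 0 := by positivity
    have h2 : 2 * a + 4 * b ≠ 0 := by positivity
    field_simp
    ring
  linarith

/-- Pinsker's inequality on a finite set. -/
lemma half_sq_sum_abs_sub_le_kl {S : Type*} [Fintype S] (p q : S → ℝ)
    (hp0 : ∀ j, 0 ≤ p j) (hq0 : ∀ j, 0 ≤ q j) (hp1 : ∑ j, p j = 1) (hq1 : ∑ j, q j = 1)
    (hsupp : ∀ j, 0 < p j → 0 < q j) :
    (∑ j, |p j - q j|) ^ 2 / 2
      ≤ ∑ j ∈ univ.filter (fun j => 0 < p j), p j * Real.log (p j / q j) := by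
  have hfilter : ∑ j ∈ univ.filter (fun j => 0 < p j), p j * Real.log (p j / q j)
      = ∑ j, p j * Real.log (p j / q j) := by
    refine sum_filter_of_ne fun j _ hj => (hp0 j).lt_of_ne' ?_
    intro h
    simp [h] at hj
  have hterm : ∀ j, 3 * (p j - q j) ^ 2 / (2 * p j + 4 * q j)
      ≤ p j * Real.log (p j / q j) - p j + q j := by
    intro j
    rcases (hp0 j).eq_or_lt with hp | hp
    · rw [← hp]
      rcases (hq0 j).eq_or_lt with hq | hq
      · simp [← hq]
      · rw [div_le_iff₀ (by positivity)]
        nlinarith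
    · exact sq_sub_div_le_mul_log_div hp (hsupp j hp)
  have hw : ∀ j, 0 ≤ 2 * p j + 4 * q j := fun j => by linarith [hp0 j, hq0 j]
  have hcs : (∑ j, |p j - q j|) ^ 2
      ≤ (∑ j, (p j - q j) ^ 2 / (2 * p j + 4 * q j)) * ∑ j, (2 * p j + 4 * q j) := by
    refine sum_sq_le_sum_mul_sum_of_sq_le_mul univ
      (fun j _ => div_nonneg (sq_nonneg _) (hw j)) (fun j _ => hw j) (fun j _ => ?_)
    rw [sq_abs]
    rcases (hw j).eq_or_lt with h | h
    · have hpj : p j = 0 := by linarith [hp0 j, hq0 j]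
      have hqj : q j = 0 := by linarith [hp0 j, hq0 j]
      simp [hpj, hqj]
    · rw [div_mul_cancel₀ _ h.ne']
  have hwsum : ∑ j, (2 * p j + 4 * q j) = 6 := by
    rw [sum_add_distrib, ← mul_sum, ← mul_sum, hp1, hq1]
    norm_num
  have hsum := sum_le_sum fun j (_ : j ∈ univ) => hterm j
  rw [sum_add_distrib, sum_sub_distrib, hp1, hq1] at hsum
  simp only [mul_div_assoc] at hsum
  rw [← mul_sum] at hsum
  rw [hwsum] at hcs
  rw [hfilter]
  linarith

/-- A lower bound for the relative entropy of exponential distributions with rates in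
`[lmin, lmax]`, in terms of the difference of their means. -/
lemma exponential_kl_ge {lmin lmax lam lamBar : ℝ} (hmin : 0 < lmin)
    (hlam : lam ∈ Set.Icc lmin lmax) (hlamBar : lamBar ∈ Set.Icc lmin lmax) :
    lmin ^ 3 / (2 * lmax) * (1 / lamBar - 1 / lam) ^ 2
      ≤ Real.log (lam / lamBar) + lamBar / lam - 1 := by
  obtain ⟨hl, hl'⟩ := hlam
  obtain ⟨hb, hb'⟩ := hlamBar
  have hl0 : 0 < lam := hmin.trans_le hl
  have hb0 : 0 < lamBar := hmin.trans_le hb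
  have hmax : 0 < lmax := hl0.trans_le hl'
  have hprod : lmin ^ 3 ≤ lam * lamBar * lmax := by
    calc lmin ^ 3 = lmin * lmin * lmin := by ring
      _ ≤ lam * lamBar * lmax := by gcongr; exact hl.trans hl'
  have hcoef : lmin ^ 3 / (2 * lmax) / (lam * lamBar) ^ 2
      ≤ 3 / (2 * lam + 4 * lamBar) / lam := by
    have hbarterm : lmin ^ 3 * lamBar ≤ lam * lamBar * lmax * lamBar :=
      mul_le_mul_of_nonneg_right hprod hb0.le
    have hsq : lmin ^ 3 ≤ lamBar ^ 2 * lmax := by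
      calc lmin ^ 3 = lmin ^ 2 * lmin := by ring
        _ ≤ lamBar ^ 2 * lmax := by gcongr; exact hl.trans hl'
    have hlamterm : lmin ^ 3 * lam ≤ lamBar ^ 2 * lmax * lam :=
      mul_le_mul_of_nonneg_right hsq hl0.le
    rw [div_div, div_div, div_le_div_iff₀ (by positivity) (by positivity)]
    have h : lmin ^ 3 * (2 * lam + 4 * lamBar) ≤ 6 * lmax * lam * lamBar ^ 2 := by
      linarith
    nlinarith [mul_le_mul_of_nonneg_right h hl0.le]
  have hterm := div_le_div_of_nonneg_right (sq_sub_div_le_mul_log_div hl0 hb0) hl0.le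
  calc lmin ^ 3 / (2 * lmax) * (1 / lamBar - 1 / lam) ^ 2
      = lmin ^ 3 / (2 * lmax) / (lam * lamBar) ^ 2 * (lam - lamBar) ^ 2 := by
        field_simp
    _ ≤ 3 / (2 * lam + 4 * lamBar) / lam * (lam - lamBar) ^ 2 :=
        mul_le_mul_of_nonneg_right hcoef (sq_nonneg _)
    _ = 3 * (lam - lamBar) ^ 2 / (2 * lam + 4 * lamBar) / lam := by ring
    _ ≤ (lam * Real.log (lam / lamBar) - lam + lamBar) / lam := hterm
    _ = Real.log (lam / lamBar) + lamBar / lam - 1 := by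
        field_simp
        ring

/-- Pinsker-type composite bound: for probability mass functions `p, q` on a finite set `S`
with `q` positive on the support of `p`, and rates `lam, lamBar ∈ [λ_min, λ_max]` with
`0 < λ_min ≤ λ_max` and `λ_min³ ≤ λ_max`, the sum of the KL divergence of `p` w.r.t. `q`
and the KL divergence of the exponential distributions with rates `lam` and `lamBar` is at
least `(λ_min³/(4 λ_max)) · ( Σ_j |p j − q j| + |1/lamBar − 1/lam| )²`. -/
theorem kl_composite_bound {S : Type*} [Fintype S]
    (lmin lmax : ℝ) (hmin : 0 < lmin) (hle : lmin ≤ lmax) (hcube : lmin ^ 3 ≤ lmax)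
    (p q : S → ℝ) (hp0 : ∀ j, 0 ≤ p j) (hq0 : ∀ j, 0 ≤ q j)
    (hp1 : ∑ j, p j = 1) (hq1 : ∑ j, q j = 1)
    (hsupp : ∀ j, 0 < p j → 0 < q j)
    (lam lamBar : ℝ) (hlam : lam ∈ Set.Icc lmin lmax) (hlamBar : lamBar ∈ Set.Icc lmin lmax) :
    (∑ j ∈ univ.filter (fun j => 0 < p j), p j * Real.log (p j / q j))
        + Real.log (lam / lamBar) + lamBar / lam - 1
      ≥ lmin ^ 3 / (4 * lmax)
          * ((∑ j, |p j - q j|) + |1 / lamBar - 1 / lam|) ^ 2 := by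
  have hmax : 0 < lmax := hmin.trans_le hle
  have hpin := half_sq_sum_abs_sub_le_kl p q hp0 hq0 hp1 hq1 hsupp
  have hexp := exponential_kl_ge hmin hlam hlamBar
  have hc0 : 0 ≤ lmin ^ 3 / (4 * lmax) := by positivity
  have hc : lmin ^ 3 / (4 * lmax) ≤ 1 / 4 := by
    rw [div_le_div_iff₀ (by positivity) (by norm_num)]
    linarith
  have hc2 : lmin ^ 3 / (2 * lmax) = 2 * (lmin ^ 3 / (4 * lmax)) := by
    field_simp
    norm_num
  rw [hc2, ← sq_abs (1 / lamBar - 1 / lam)] at hexp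
  generalize lmin ^ 3 / (4 * lmax) = c at *
  generalize |1 / lamBar - 1 / lam| = b at *
  generalize (∑ j, |p j - q j|) = a at *
  have h1 : c * (a + b) ^ 2 ≤ c * (2 * a ^ 2 + 2 * b ^ 2) :=
    mul_le_mul_of_nonneg_left (by nlinarith [sq_nonneg (a - b)]) hc0
  have h2 : c * a ^ 2 ≤ 1 / 4 * a ^ 2 := mul_le_mul_of_nonneg_right hc (sq_nonneg a)
  linarith
end

section
/- Let 0 < λ₁ ≤ λ₂. Suppose that for every T > 0 there are ℕ-valued random variables A¹_T, Y_T, A²_T on a common probability space such that A¹_T ≤ Y_T ≤ A²_T almost surely, A¹_T is Poisson distributed with mean λ₁ T, and A²_T is Poisson distributed with mean λ₂ T. Then lim_{T → ∞} E[ log(Y_T + 2) ] / log T = 1. -/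
open MeasureTheory ProbabilityTheory Filter

/-- The series of the mean of a Poisson law of rate `r`. -/
theorem hasSum_poisson_mul_natCast (r : NNReal) :
    HasSum (fun n : ℕ ↦ Real.exp (-r) * r ^ n / n.factorial * (n : ℝ)) r := by
  rw [← hasSum_nat_add_iff' 1]
  have h := (hasSum_one_poissonMeasure r).mul_left (r : ℝ)
  simp only [Finset.range_one, Finset.sum_singleton, Nat.cast_zero, mul_zero, sub_zero]
  rw [mul_one] at h
  convert! h using 2 with n
  rw [Nat.factorial_succ, pow_succ]
  push_cast
  field_simp

theorem integrable_natCast_poissonMeasure (r : NNReal) :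
    Integrable (fun n : ℕ ↦ (n : ℝ)) (poissonMeasure r) := by
  rw [integrable_poissonMeasure_iff]
  simpa using (hasSum_poisson_mul_natCast r).summable

theorem integral_natCast_poissonMeasure (r : NNReal) :
    ∫ n : ℕ, (n : ℝ) ∂poissonMeasure r = r := by
  rw [integral_poissonMeasure]
  exact (hasSum_poisson_mul_natCast r).tsum_eq

theorem integrable_natCast_add_one_inv_poissonMeasure (r : NNReal) :
    Integrable (fun n : ℕ ↦ ((n : ℝ) + 1)⁻¹) (poissonMeasure r) := by
  refine Integrable.of_bound .of_discrete 1 (.of_forall fun n ↦ ?_)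
  rw [Real.norm_of_nonneg (by positivity)]
  exact inv_le_one_of_one_le₀ (by linarith [n.cast_nonneg (α := ℝ)])

theorem mul_integral_natCast_add_one_inv_poissonMeasure_le (r : NNReal) :
    r * ∫ n : ℕ, ((n : ℝ) + 1)⁻¹ ∂poissonMeasure r ≤ 1 := by
  have h := (hasSum_integral_poissonMeasure
    (integrable_natCast_add_one_inv_poissonMeasure r)).mul_left (r : ℝ)
  have h' := (hasSum_nat_add_iff' 1).mpr (hasSum_one_poissonMeasure r)
  have heq : (r : ℝ) * ∫ n : ℕ, ((n : ℝ) + 1)⁻¹ ∂poissonMeasure r = 1 - Real.exp (-r) := by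
    refine h.unique ?_
    convert! h' using 2 with n
    · rw [Nat.factorial_succ, pow_succ, smul_eq_mul]
      push_cast
      field_simp
    · simp
  rw [heq]
  linarith [Real.exp_pos (-(r : ℝ))]

theorem log_le_log_add_div_sub_one {c x : ℝ} (hc : 0 < c) (hx : 0 < x) :
    Real.log x ≤ Real.log c + (x / c - 1) := by
  have h := Real.log_le_sub_one_of_pos (div_pos hx hc)
  rw [Real.log_div hx.ne' hc.ne'] at h
  linarith

theorem integrable_log_natCast_add_two_poissonMeasure (r : NNReal) :
    Integrable (fun n : ℕ ↦ Real.log ((n : ℝ) + 2)) (poissonMeasure r) := by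
  refine ((integrable_natCast_poissonMeasure r).add (integrable_const 2)).mono'
    .of_discrete (.of_forall fun n ↦ ?_)
  have hn : (0 : ℝ) ≤ n := n.cast_nonneg
  rw [Real.norm_of_nonneg (Real.log_nonneg (by linarith))]
  exact Real.log_le_self (by linarith)

theorem integral_log_natCast_add_two_poissonMeasure_le (r : NNReal) :
    ∫ n : ℕ, Real.log ((n : ℝ) + 2) ∂poissonMeasure r ≤ Real.log (r + 2) := by
  have hc : (0 : ℝ) < r + 2 := by positivity
  have hint : Integrable (fun n : ℕ ↦ (n : ℝ) + 2) (poissonMeasure r) :=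
    (integrable_natCast_poissonMeasure r).add (integrable_const 2)
  have hint' : Integrable (fun n : ℕ ↦ ((n : ℝ) + 2) / (r + 2) - 1) (poissonMeasure r) :=
    (hint.div_const _).sub (integrable_const 1)
  calc ∫ n : ℕ, Real.log ((n : ℝ) + 2) ∂poissonMeasure r
      ≤ ∫ n : ℕ, (Real.log (r + 2) + (((n : ℝ) + 2) / (r + 2) - 1)) ∂poissonMeasure r :=
        integral_mono (integrable_log_natCast_add_two_poissonMeasure r)
          ((integrable_const _).add hint')
          fun n ↦ log_le_log_add_div_sub_one hc (by positivity)
    _ = Real.log (r + 2) := by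
        rw [integral_add (integrable_const _) hint',
          integral_sub (hint.div_const _) (integrable_const 1), integral_div,
          integral_add (integrable_natCast_poissonMeasure r) (integrable_const 2),
          integral_natCast_poissonMeasure]
        simp [div_self hc.ne']

theorem log_le_integral_log_natCast_add_two_poissonMeasure {r : NNReal} (hr : 0 < r) :
    Real.log r ≤ ∫ n : ℕ, Real.log ((n : ℝ) + 2) ∂poissonMeasure r := by
  have hinv := integrable_natCast_add_one_inv_poissonMeasure r
  calc Real.log r ≤ Real.log r + 1 - r * ∫ n : ℕ, ((n : ℝ) + 1)⁻¹ ∂poissonMeasure r := by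
        linarith [mul_integral_natCast_add_one_inv_poissonMeasure_le r]
    _ = ∫ n : ℕ, (Real.log r + 1 - r * ((n : ℝ) + 1)⁻¹) ∂poissonMeasure r := by
        rw [integral_sub (integrable_const _) (hinv.const_mul _), integral_const_mul]
        simp
    _ ≤ ∫ n : ℕ, Real.log ((n : ℝ) + 2) ∂poissonMeasure r := by
        refine integral_mono ((integrable_const _).sub (hinv.const_mul _))
          (integrable_log_natCast_add_two_poissonMeasure r) fun n ↦ ?_
        have h := log_le_log_add_div_sub_one (c := (n : ℝ) + 1) (by positivity)
          (NNReal.coe_pos.mpr hr)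
        have h' : Real.log ((n : ℝ) + 1) ≤ Real.log ((n : ℝ) + 2) :=
          Real.log_le_log (by positivity) (by linarith)
        rw [div_eq_mul_inv] at h
        dsimp only
        linarith

theorem tendsto_log_const_mul_div_log {c : ℝ} (hc : 0 < c) :
    Tendsto (fun T : ℝ ↦ Real.log (c * T) / Real.log T) atTop (nhds 1) := by
  have h := (Real.tendsto_log_atTop.const_div_atTop (Real.log c)).add_const 1
  rw [zero_add] at h
  refine h.congr' ?_
  filter_upwards [eventually_gt_atTop 1] with T hT
  have hlog : Real.log T ≠ 0 := (Real.log_pos hT).ne'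
  rw [Real.log_mul hc.ne' (by positivity), add_div, div_self hlog]

/-- Logarithmic moment bounds for a variable lying between two Poisson variables. -/
theorem integral_log_mem_Icc_of_poisson_sandwich {Ω : Type*} [MeasurableSpace Ω]
    {μ : Measure Ω} [IsProbabilityMeasure μ] {A₁ Y A₂ : Ω → ℕ} {r₁ r₂ : NNReal} (hr₁ : 0 < r₁)
    (hA₁ : Measurable A₁) (hY : Measurable Y) (hA₂ : Measurable A₂)
    (hsand : ∀ᵐ ω ∂μ, A₁ ω ≤ Y ω ∧ Y ω ≤ A₂ ω)
    (hlaw₁ : μ.map A₁ = poissonMeasure r₁) (hlaw₂ : μ.map A₂ = poissonMeasure r₂) :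
    ∫ ω, Real.log ((Y ω : ℝ) + 2) ∂μ ∈ Set.Icc (Real.log r₁) (Real.log (r₂ + 2)) := by
  have hlog_mono {m n : ℕ} (h : m ≤ n) : Real.log ((m : ℝ) + 2) ≤ Real.log ((n : ℝ) + 2) :=
    Real.log_le_log (by positivity) (by gcongr)
  have hint {A : Ω → ℕ} {r : NNReal} (hA : Measurable A) (hlaw : μ.map A = poissonMeasure r) :
      Integrable (fun ω ↦ Real.log ((A ω : ℝ) + 2)) μ :=
    (hlaw ▸ integrable_log_natCast_add_two_poissonMeasure r).comp_measurable hA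
  have heq {A : Ω → ℕ} {r : NNReal} (hA : Measurable A) (hlaw : μ.map A = poissonMeasure r) :
      ∫ ω, Real.log ((A ω : ℝ) + 2) ∂μ = ∫ n : ℕ, Real.log ((n : ℝ) + 2) ∂poissonMeasure r := by
    rw [← hlaw, integral_map hA.aemeasurable .of_discrete]
  have hintY : Integrable (fun ω ↦ Real.log ((Y ω : ℝ) + 2)) μ := by
    refine (hint hA₂ hlaw₂).mono' ?_ ?_
    · exact ((Measurable.of_discrete (f := fun n : ℕ ↦ Real.log ((n : ℝ) + 2))).comp
        hY).aestronglyMeasurable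
    filter_upwards [hsand] with ω hω
    rw [Real.norm_of_nonneg (Real.log_nonneg (by linarith [(Y ω).cast_nonneg (α := ℝ)]))]
    exact hlog_mono hω.2
  constructor
  · refine (log_le_integral_log_natCast_add_two_poissonMeasure hr₁).trans ?_
    rw [← heq hA₁ hlaw₁]
    exact integral_mono_ae (hint hA₁ hlaw₁) hintY (hsand.mono fun ω hω ↦ hlog_mono hω.1)
  · refine le_trans ?_ (integral_log_natCast_add_two_poissonMeasure_le r₂)
    rw [← heq hA₂ hlaw₂]
    exact integral_mono_ae hintY (hint hA₂ hlaw₂) (hsand.mono fun ω hω ↦ hlog_mono hω.2)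

/-- If for each `T > 0` an `ℕ`-valued random variable `Y_T` is sandwiched pathwise
between Poisson random variables with means `λ₁ T` and `λ₂ T` (where `0 < λ₁ ≤ λ₂`),
then `E[log(Y_T + 2)] / log T → 1` as `T → ∞`. -/
theorem sandwiched_poisson_log_limit
    (lam₁ lam₂ : ℝ) (h₁ : 0 < lam₁) (h₁₂ : lam₁ ≤ lam₂)
    (Ω : ℝ → Type*) [∀ T, MeasurableSpace (Ω T)]
    (μ : ∀ T, Measure (Ω T)) [∀ T, IsProbabilityMeasure (μ T)]
    (A₁ Y A₂ : ∀ T, Ω T → ℕ)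
    (hmeas₁ : ∀ T, Measurable (A₁ T)) (hmeasY : ∀ T, Measurable (Y T))
    (hmeas₂ : ∀ T, Measurable (A₂ T))
    (hsand : ∀ T, 0 < T → ∀ᵐ ω ∂(μ T), A₁ T ω ≤ Y T ω ∧ Y T ω ≤ A₂ T ω)
    (hlaw₁ : ∀ T, 0 < T →
      Measure.map (A₁ T) (μ T) = poissonMeasure (Real.toNNReal (lam₁ * T)))
    (hlaw₂ : ∀ T, 0 < T →
      Measure.map (A₂ T) (μ T) = poissonMeasure (Real.toNNReal (lam₂ * T))) :
    Tendsto (fun T : ℝ =>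
        (∫ ω, Real.log ((Y T ω : ℝ) + 2) ∂(μ T)) / Real.log T)
      atTop (nhds 1) := by
  have h₂ : 0 < lam₂ := h₁.trans_le h₁₂
  have hbounds {T : ℝ} (hT : 0 < T) := integral_log_mem_Icc_of_poisson_sandwich
    (Real.toNNReal_pos.mpr (mul_pos h₁ hT)) (hmeas₁ T) (hmeasY T) (hmeas₂ T)
    (hsand T hT) (hlaw₁ T hT) (hlaw₂ T hT)
  refine tendsto_of_tendsto_of_tendsto_of_le_of_le' (tendsto_log_const_mul_div_log h₁)
    (tendsto_log_const_mul_div_log (add_pos h₂ two_pos)) ?_ ?_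
  · filter_upwards [eventually_gt_atTop 1] with T hT
    have hT₀ : 0 < T := one_pos.trans hT
    have h := (hbounds hT₀).1
    rw [Real.coe_toNNReal _ (by positivity)] at h
    exact div_le_div_of_nonneg_right h (Real.log_pos hT).le
  · filter_upwards [eventually_gt_atTop 1] with T hT
    have hT₀ : 0 < T := one_pos.trans hT
    have h := (hbounds hT₀).2
    rw [Real.coe_toNNReal _ (by positivity)] at h
    refine div_le_div_of_nonneg_right (h.trans ?_) (Real.log_pos hT).le
    exact Real.log_le_log (by positivity) (by linarith)
end
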